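/- For every t > 0 and x ∈ ℝ, ∫₀ᵗ p(t−s, x) ds = 2t·p(t,x) − 2|x|·Φ̃(t,|x|). -/

import Mathlib

open MeasureTheory Real Set

/-- The heat kernel `p(t,x) = (2πt)^{-1/2} exp(-x²/(2t))`. -/
noncomputable def heatK (t x : ℝ) : ℝ :=
  (Real.sqrt (2 * Real.pi * t))⁻¹ * Real.exp (-x ^ 2 / (2 * t))

/-- The Gaussian tail `Φ̃(t,x) = ∫ₓ^∞ p(t,y) dy`. -/
noncomputable def gaussTail (t x : ℝ) : ℝ := ∫ y in Set.Ioi x, heatK t y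

open scoped Topology
open Filter

/-- The heat kernel is even in space. -/
theorem heatK_abs (t x : ℝ) : heatK t |x| = heatK t x := by
  simp [heatK, sq_abs]

theorem continuous_heatK (t : ℝ) : Continuous (heatK t) := by
  unfold heatK
  fun_prop

theorem integrable_heatK {t : ℝ} (ht : 0 < t) : Integrable (heatK t) := by
  have h := (integrable_exp_neg_mul_sq (b := 1 / (2 * t)) (by positivity)).const_mul
    (√(2 * π * t))⁻¹
  refine h.congr (ae_of_all _ fun y => ?_)
  simp only [heatK]
  congr 2
  ring

/-- Diffusive scaling of the heat kernel. -/
theorem heatK_eq_scaled {t : ℝ} (ht : 0 < t) (x : ℝ) :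
    heatK t x = (√t)⁻¹ * heatK 1 ((√t)⁻¹ * x) := by
  have h : (√t)⁻¹ ^ 2 = t⁻¹ := by rw [inv_pow, sq_sqrt ht.le]
  simp only [heatK, mul_pow, h, mul_one]
  rw [sqrt_mul (by positivity), mul_inv, ← mul_assoc, mul_comm (√t)⁻¹]
  congr 2
  field_simp

theorem gaussTail_eq_scaled {t : ℝ} (ht : 0 < t) (x : ℝ) :
    gaussTail t x = gaussTail 1 ((√t)⁻¹ * x) := by
  have hb : 0 < (√t)⁻¹ := by positivity
  unfold gaussTail
  simp_rw [heatK_eq_scaled ht]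
  rw [integral_const_mul, integral_comp_mul_left_Ioi (heatK 1) x hb, smul_eq_mul,
    mul_inv_cancel_left₀ hb.ne']

theorem gaussTail_eq_sub {t : ℝ} (ht : 0 < t) (x : ℝ) :
    gaussTail t x = gaussTail t 0 - ∫ y in (0:ℝ)..x, heatK t y := by
  have h := intervalIntegral.integral_interval_add_Ioi (a := (0:ℝ)) (b := x)
    (integrable_heatK ht).integrableOn (integrable_heatK ht).integrableOn
  unfold gaussTail
  linarith

theorem hasDerivAt_gaussTail {t : ℝ} (ht : 0 < t) (x : ℝ) :
    HasDerivAt (gaussTail t) (-heatK t x) x := by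
  have h : gaussTail t = fun x => gaussTail t 0 - ∫ y in (0:ℝ)..x, heatK t y :=
    funext (gaussTail_eq_sub ht)
  rw [h]
  exact ((continuous_heatK t).integral_hasStrictDerivAt 0 x).hasDerivAt.const_sub _

theorem tendsto_gaussTail_atTop {t : ℝ} (ht : 0 < t) :
    Tendsto (gaussTail t) atTop (𝓝 0) := by
  have h : gaussTail t = fun x => gaussTail t 0 - ∫ y in (0:ℝ)..x, heatK t y :=
    funext (gaussTail_eq_sub ht)
  have h' := intervalIntegral_tendsto_integral_Ioi 0 (integrable_heatK ht).integrableOn tendsto_id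
  rw [h]
  simpa [gaussTail] using h'.const_sub (gaussTail t 0)

theorem heatK_nonneg (t x : ℝ) : 0 ≤ heatK t x := by
  unfold heatK
  positivity

theorem heatK_le {t : ℝ} (ht : 0 < t) (x : ℝ) : heatK t x ≤ (√(2 * π * t))⁻¹ := by
  unfold heatK
  refine mul_le_of_le_one_right (by positivity) (exp_le_one_iff.mpr ?_)
  rw [neg_div, neg_nonpos]
  positivity

theorem hasDerivAt_heatK_time {t : ℝ} (ht : 0 < t) (x : ℝ) :
    HasDerivAt (fun u => heatK u x) (heatK t x * (x ^ 2 / (2 * t ^ 2) - 1 / (2 * t))) t := by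
  have hs : 0 < √(2 * π * t) := by positivity
  have h1 := (((hasDerivAt_id t).const_mul (2 * π)).sqrt (by simp; positivity)).inv hs.ne'
  have h2 := (((hasDerivAt_id t).const_mul 2).fun_inv (by simp; positivity)).const_mul
    (-x ^ 2) |>.exp
  refine (h1.mul h2).congr_deriv ?_
  simp only [id, heatK, Pi.inv_apply, div_eq_mul_inv (-x ^ 2)]
  have hq : √(2 * π * t) ^ 2 = 2 * π * t := sq_sqrt (by positivity)
  rw [hq]
  field_simp
  ring

theorem hasDerivAt_gaussTail_time {t : ℝ} (ht : 0 < t) (x : ℝ) :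
    HasDerivAt (fun u => gaussTail u x) (x / (2 * t) * heatK t x) t := by
  have hs : 0 < √t := by positivity
  have h1 := ((hasDerivAt_sqrt ht.ne').fun_inv hs.ne').mul_const x
  have h2 := (hasDerivAt_gaussTail one_pos ((√t)⁻¹ * x)).comp t h1
  refine (h2.congr_of_eventuallyEq ?_).congr_deriv ?_
  · filter_upwards [lt_mem_nhds ht] with u hu using gaussTail_eq_scaled hu x
  · rw [heatK_eq_scaled ht, sq_sqrt ht.le]
    field_simp

theorem intervalIntegrable_heatK_time {t : ℝ} (ht : 0 < t) (x : ℝ) :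
    IntervalIntegrable (fun u => heatK u x) volume 0 t := by
  have h := (intervalIntegral.intervalIntegrable_rpow' (a := 0) (b := t)
    (r := -(1 / 2)) (by norm_num)).const_mul (√(2 * π))⁻¹
  refine h.mono_fun (Measurable.aestronglyMeasurable (by unfold heatK; fun_prop)) ?_
  rw [uIoc_of_le ht.le]
  filter_upwards [ae_restrict_mem measurableSet_Ioc] with u hu
  rw [norm_of_nonneg (heatK_nonneg u x), rpow_neg hu.1.le, ← sqrt_eq_rpow, ← mul_inv,
    ← sqrt_mul (by positivity), norm_of_nonneg (by positivity)]
  exact heatK_le hu.1 x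

theorem tendsto_mul_heatK_zero (x : ℝ) :
    Tendsto (fun u => 2 * u * heatK u x) (𝓝[>] 0) (𝓝 0) := by
  have h : Tendsto (fun u => √(2 * π * u)) (𝓝[>] 0) (𝓝 0) := by
    have : Continuous fun u => √(2 * π * u) := by fun_prop
    simpa using (this.tendsto 0).mono_left nhdsWithin_le_nhds
  refine squeeze_zero' ?_ ?_ h
  · filter_upwards [self_mem_nhdsWithin] with u (hu : 0 < u)
    exact mul_nonneg (by positivity) (heatK_nonneg u x)
  · filter_upwards [self_mem_nhdsWithin] with u (hu : 0 < u)
    have hs : 0 < √(2 * π * u) := by positivity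
    have hq : √(2 * π * u) ^ 2 = 2 * π * u := sq_sqrt (by positivity)
    calc 2 * u * heatK u x ≤ 2 * u * (√(2 * π * u))⁻¹ :=
          mul_le_mul_of_nonneg_left (heatK_le hu x) (by positivity)
      _ ≤ √(2 * π * u) := by
          rw [← div_eq_mul_inv, div_le_iff₀ hs]
          nlinarith [pi_gt_three]

theorem tendsto_mul_gaussTail_zero {x : ℝ} (hx : 0 ≤ x) :
    Tendsto (fun u => 2 * x * gaussTail u x) (𝓝[>] 0) (𝓝 0) := by
  rcases hx.eq_or_lt with rfl | hx
  · simp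
  have hs : Tendsto (fun u => √u) (𝓝[>] 0) (𝓝[>] 0) := by
    refine tendsto_nhdsWithin_iff.mpr ⟨?_, ?_⟩
    · simpa using (continuous_sqrt.tendsto 0).mono_left nhdsWithin_le_nhds
    · filter_upwards [self_mem_nhdsWithin] with u hu using sqrt_pos.mpr hu
  have h := (tendsto_gaussTail_atTop one_pos).comp
    ((tendsto_inv_nhdsGT_zero.comp hs).atTop_mul_const hx)
  have h' : Tendsto (fun u => gaussTail u x) (𝓝[>] 0) (𝓝 0) := by
    refine h.congr' ?_
    filter_upwards [self_mem_nhdsWithin] with u hu using (gaussTail_eq_scaled hu x).symm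
  simpa using h'.const_mul (2 * x)

/-- For every `t > 0` and `x ∈ ℝ`, `∫₀ᵗ p(t-s,x) ds = 2t·p(t,x) - 2|x|·Φ̃(t,|x|)`. -/
theorem time_integral_heat_kernel_closed_form (t : ℝ) (ht : 0 < t) (x : ℝ) :
    (∫ s in (0:ℝ)..t, heatK (t - s) x) = 2 * t * heatK t x - 2 * |x| * gaussTail t |x| := by
  have hderiv : ∀ u : ℝ, 0 < u →
      HasDerivAt (fun u => 2 * u * heatK u |x| - 2 * |x| * gaussTail u |x|) (heatK u |x|) u := by
    intro u hu
    have h1 := ((hasDerivAt_id u).const_mul 2).mul (hasDerivAt_heatK_time hu |x|)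
    have h2 := (hasDerivAt_gaussTail_time hu |x|).const_mul (2 * |x|)
    refine (h1.sub h2).congr_deriv ?_
    simp only [id]
    field_simp
    ring
  have h0 := (tendsto_mul_heatK_zero |x|).sub (tendsto_mul_gaussTail_zero (abs_nonneg x))
  have key := intervalIntegral.integral_eq_sub_of_hasDerivAt_of_tendsto ht
    (fun u hu => hderiv u hu.1) (intervalIntegrable_heatK_time ht |x|) h0
    ((hderiv t ht).continuousAt.tendsto.mono_left nhdsWithin_le_nhds)
  rw [intervalIntegral.integral_comp_sub_left (fun u => heatK u x), sub_self, sub_zero]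
  simpa [heatK_abs] using key
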